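/- arXiv:2003.03643 — 2 statements merged into one kernel-verified Lean document; each statement's English description precedes it below -/
import Mathlib

section
/- Let G_0 be the Green function of ℝ^N \ B(0,1), N ≥ 2. Then: (i) for |w| > 1 and |z| = 1, the derivative of G_0(w,·) at z in the direction ν_z = −z equals (1/(Nω_N)) (1 − |w|²)/|w−z|^N; (ii) there is a constant C such that for all |w| > 1 and |z| > 1 and each i, |∂G_0(w,z)/∂w_i| ≤ C |z|/|w−z|^{N−1}; (iii) as |w| → ∞, uniformly in |z| > 1, ∂G_0(w,z)/∂w_i = −(1/(Nω_N)) (w_i − z_i)/|w−z|^N + O(1/(|w|^{N−1} |z|^{N−2})). -/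
open Filter Set Topology Metric MeasureTheory

noncomputable section

/-- Euclidean space `ℝ^N`. -/
abbrev EN (N : ℕ) := EuclideanSpace ℝ (Fin N)

/-- Partial derivative `∂u/∂x_i`. -/
def pd {N : ℕ} (u : EN N → ℝ) (i : Fin N) (x : EN N) : ℝ :=
  fderiv ℝ u x (EuclideanSpace.single i 1)

/-- Second partial derivative `∂²u/∂x_i∂x_j`. -/
def pd2 {N : ℕ} (u : EN N → ℝ) (i j : Fin N) (x : EN N) : ℝ :=
  fderiv ℝ (fun y => pd u i y) x (EuclideanSpace.single j 1)

/-- The Laplacian `Δu`. -/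
def lap {N : ℕ} (u : EN N → ℝ) (x : EN N) : ℝ := ∑ i, pd2 u i i x

/-- The Hessian matrix of `u` at `x`. -/
def hess {N : ℕ} (u : EN N → ℝ) (x : EN N) : Matrix (Fin N) (Fin N) ℝ :=
  Matrix.of fun i j => pd2 u i j x

/-- `u` is a (classical, positive) solution of `-Δu = f(u)` in `D`, `u > 0` in `D`,
`u = 0` on `∂D`. -/
def IsSol {N : ℕ} (f : ℝ → ℝ) (D : Set (EN N)) (u : EN N → ℝ) : Prop :=
  ContDiffOn ℝ 2 u D ∧ (∀ x ∈ D, lap u x = - f (u x)) ∧ (∀ x ∈ D, 0 < u x) ∧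
    ContinuousOn u (closure D) ∧ (∀ x ∈ frontier D, u x = 0)

/-- `u ε → u₀` in `C²(K)` as `ε → 0⁺`: uniform convergence on `K` of the functions and of
their first and second partial derivatives. -/
def C2ConvOn {N : ℕ} (u : ℝ → EN N → ℝ) (u₀ : EN N → ℝ) (K : Set (EN N)) : Prop :=
  TendstoUniformlyOn (fun ε => u ε) u₀ (𝓝[>] (0:ℝ)) K ∧
    (∀ i, TendstoUniformlyOn (fun ε => pd (u ε) i) (pd u₀ i) (𝓝[>] (0:ℝ)) K) ∧
    (∀ i j, TendstoUniformlyOn (fun ε => pd2 (u ε) i j) (pd2 u₀ i j) (𝓝[>] (0:ℝ)) K)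

/-- The common setting of the paper: `Ω` a bounded domain, `P ∈ Ω`, `f` smooth, and for every
small `ε > 0`, `u ε` solves `-Δu = f(u)`, `u > 0` in `Ω_ε = Ω \ B(P,ε)`, `u = 0` on `∂Ω_ε`,
with a uniform bound `|u ε| ≤ C`, and `u₀` is the weak limit: a solution on `Ω` such that
`u ε → u₀` in `C²(K)` for every compact `K ⊆ Ω \ {P}`. -/
def Setting {N : ℕ} (Ω : Set (EN N)) (P : EN N) (f : ℝ → ℝ) (ε₀ C : ℝ)
    (u : ℝ → EN N → ℝ) (u₀ : EN N → ℝ) : Prop :=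
  IsOpen Ω ∧ Bornology.IsBounded Ω ∧ P ∈ Ω ∧ ContDiff ℝ (⊤ : ℕ∞) f ∧ 0 < ε₀ ∧
    (∀ ε ∈ Ioo (0:ℝ) ε₀, IsSol f (Ω \ closedBall P ε) (u ε)) ∧
    (∀ ε ∈ Ioo (0:ℝ) ε₀, ∀ x ∈ Ω \ closedBall P ε, |u ε x| ≤ C) ∧
    IsSol f Ω u₀ ∧
    (∀ K ⊆ Ω \ {P}, IsCompact K → C2ConvOn u u₀ K)

/-- `ω_N`: the volume of the unit ball of `ℝ^N`. -/
def omegaN (N : ℕ) : ℝ := (volume (ball (0 : EN N) 1)).toReal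

/-- The fundamental solution `S(x,y)` of `-Δ` in `ℝ^N`. -/
def fundS (N : ℕ) (x y : EN N) : ℝ :=
  if N = 2 then -(1 / (2 * Real.pi)) * Real.log ‖x - y‖
  else (1 / ((N:ℝ) * ((N:ℝ) - 2) * omegaN N)) * ‖x - y‖ ^ ((2:ℝ) - (N:ℝ))

/-- `H` is the regular part of the Dirichlet Green function of `-Δ` on `D` (relative to the
fundamental solution `S`): for `y ∈ D`, `H(·,y)` is harmonic in `D`, continuous up to the
boundary, and `G = S + H` vanishes on `∂D`. -/
def IsRegularPart {N : ℕ} (D : Set (EN N)) (S H : EN N → EN N → ℝ) : Prop :=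
  ∀ y ∈ D, ContDiffOn ℝ 2 (fun x => H x y) D ∧
    (∀ x ∈ D, lap (fun x' => H x' y) x = 0) ∧
    ContinuousOn (fun x => H x y) (closure D) ∧
    (∀ x ∈ frontier D, S x y + H x y = 0)

/-- Condition (★) of the paper: with `G = S + H` the Green function of `Ω`, for each `i`,
`∫_{Ω_ε} (f(u_ε) - f(u₀)) ∂G(x,y)/∂x_i dy = o(|x-P|) + o(ε^{N-2}/|x-P|^{N-1})`
(resp. `o(|x-P|) + o(1/(|x-P||log ε|))` for `N = 2`) as `|x-P| → 0`, `|x-P|/ε → ∞`. -/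
def StarCond {N : ℕ} (Ω : Set (EN N)) (P : EN N) (f : ℝ → ℝ)
    (u : ℝ → EN N → ℝ) (u₀ : EN N → ℝ) (H : EN N → EN N → ℝ) : Prop :=
  ∀ i : Fin N, ∀ δ > (0:ℝ), ∃ η > (0:ℝ), ∀ ε ∈ Ioo (0:ℝ) η, ∀ x : EN N,
    ‖x - P‖ ≤ η → ε ≤ η * ‖x - P‖ →
      |∫ y in Ω \ closedBall P ε,
          (f (u ε y) - f (u₀ y)) * pd (fun x' => fundS N x' y + H x' y) i x ∂volume|
        ≤ if N = 2 then δ * (‖x - P‖ + 1 / (‖x - P‖ * |Real.log ε|))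
          else δ * (‖x - P‖ + ε ^ (N - 2) / ‖x - P‖ ^ (N - 1))

/-- The Green function `G₀` of `ℝ^N \ B(0,1)`. -/
def G0 (N : ℕ) (w z : EN N) : ℝ :=
  if N = 2 then
    -(1 / (2 * Real.pi)) * (Real.log ‖w - z‖ - Real.log ‖‖w‖ • z - ‖w‖⁻¹ • w‖)
  else
    (1 / ((N:ℝ) * ((N:ℝ) - 2) * omegaN N)) *
      (‖w - z‖ ^ ((2:ℝ) - (N:ℝ)) - ‖‖w‖ • z - ‖w‖⁻¹ • w‖ ^ ((2:ℝ) - (N:ℝ)))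

/-- The radial profile of the fundamental solution as a function of the squared distance. -/
def radialProfile (N : ℕ) (s : ℝ) : ℝ :=
  if N = 2 then -(1 / (4 * Real.pi)) * Real.log s
  else (1 / ((N:ℝ) * ((N:ℝ) - 2) * omegaN N)) * s ^ (((2:ℝ) - (N:ℝ)) / 2)

/-- The squared distance from `‖w‖ • z` to `‖w‖⁻¹ • w`, as a polynomial in `w` and `z`. -/
def reflSq {N : ℕ} (w z : EN N) : ℝ := ‖w‖ ^ 2 * ‖z‖ ^ 2 - 2 * inner ℝ w z + 1

lemma reflSq_comm {N : ℕ} (w z : EN N) : reflSq w z = reflSq z w := by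
  simp only [reflSq, real_inner_comm]
  ring

lemma norm_smul_sub_inv_smul_sq {N : ℕ} {w : EN N} (hw : w ≠ 0) (z : EN N) :
    ‖‖w‖ • z - ‖w‖⁻¹ • w‖ ^ 2 = reflSq w z := by
  have h : ‖w‖ ≠ 0 := norm_ne_zero_iff.mpr hw
  rw [norm_sub_sq_real, norm_smul, norm_smul, inner_smul_left, inner_smul_right,
    real_inner_comm, reflSq]
  simp only [norm_norm, norm_inv, conj_trivial]
  field_simp

lemma reflSq_eq_add {N : ℕ} (w z : EN N) :
    reflSq w z = ‖w - z‖ ^ 2 + (‖w‖ ^ 2 - 1) * (‖z‖ ^ 2 - 1) := by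
  rw [norm_sub_sq_real, reflSq]
  ring

lemma sq_le_reflSq {N : ℕ} (w z : EN N) : (‖w‖ * ‖z‖ - 1) ^ 2 ≤ reflSq w z := by
  have := real_inner_le_norm w z
  rw [reflSq]
  nlinarith

lemma norm_sq_smul_sub_sq {N : ℕ} (w z : EN N) :
    ‖‖z‖ ^ 2 • w - z‖ ^ 2 = ‖z‖ ^ 2 * reflSq w z := by
  rw [norm_sub_sq_real, norm_smul, inner_smul_left, reflSq]
  simp only [norm_pow, norm_norm, conj_trivial]
  ring

lemma omegaN_pos (N : ℕ) : 0 < omegaN N :=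
  ENNReal.toReal_pos (measure_ball_pos volume 0 one_pos).ne' measure_ball_lt_top.ne

lemma omegaN_two : omegaN 2 = Real.pi := by
  rw [omegaN, EuclideanSpace.volume_ball_fin_two]
  simp [Real.pi_nonneg]

lemma G0_eq_radialProfile_sub {N : ℕ} {w : EN N} (hw : w ≠ 0) (z : EN N) :
    G0 N w z = radialProfile N (‖w - z‖ ^ 2) - radialProfile N (reflSq w z) := by
  have hpow (x : ℝ) (hx : 0 ≤ x) :
      (x ^ 2) ^ (((2:ℝ) - (N:ℝ)) / 2) = x ^ ((2:ℝ) - (N:ℝ)) := by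
    rw [← Real.rpow_natCast_mul hx]
    congr 1
    push_cast
    ring
  rw [← norm_smul_sub_inv_smul_sq hw, G0, radialProfile, radialProfile]
  split_ifs
  · rw [Real.log_pow, Real.log_pow]
    push_cast
    ring
  · rw [hpow _ (norm_nonneg _), hpow _ (norm_nonneg _)]
    ring

lemma hasDerivAt_radialProfile {N : ℕ} (hN : 2 ≤ N) {r : ℝ} (hr : 0 < r) :
    HasDerivAt (radialProfile N) (-(1 / (N * omegaN N)) / r ^ N / 2) (r ^ 2) := by
  have hr2 : r ^ 2 ≠ 0 := by positivity
  have hω := omegaN_pos N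
  by_cases h : N = 2
  · subst h
    have hP : radialProfile 2 = fun s => -(1 / (4 * Real.pi)) * Real.log s := by
      ext s
      simp [radialProfile]
    rw [hP, omegaN_two]
    refine ((Real.hasDerivAt_log hr2).const_mul (-(1 / (4 * Real.pi)))).congr_deriv ?_
    have := Real.pi_pos
    push_cast
    field_simp
    norm_num
  · have hP : radialProfile N = fun s =>
        (1 / ((N:ℝ) * ((N:ℝ) - 2) * omegaN N)) * s ^ (((2:ℝ) - (N:ℝ)) / 2) := by
      ext s
      simp [radialProfile, h]
    have hN3 : (3:ℝ) ≤ N := by exact_mod_cast (by omega : 3 ≤ N)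
    have hN2 : (N:ℝ) - 2 ≠ 0 := by linarith
    have hN0 : (N:ℝ) ≠ 0 := by linarith
    have hpow : (r ^ 2) ^ (((2:ℝ) - (N:ℝ)) / 2 - 1) = (r ^ N)⁻¹ := by
      rw [← Real.rpow_natCast_mul hr.le, ← Real.rpow_natCast, ← Real.rpow_neg hr.le]
      congr 1
      push_cast
      ring
    rw [hP]
    refine ((Real.hasDerivAt_rpow_const (p := ((2:ℝ) - (N:ℝ)) / 2) (Or.inl hr2)).const_mul
      (1 / ((N:ℝ) * ((N:ℝ) - 2) * omegaN N))).congr_deriv ?_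
    rw [hpow]
    field_simp
    ring

lemma tendsto_radialProfile_atTop {N : ℕ} (hN : 2 ≤ N) :
    Tendsto (radialProfile N) (𝓝[>] 0) atTop := by
  have hω := omegaN_pos N
  by_cases h : N = 2
  · subst h
    have hP : radialProfile 2 = fun s => -(1 / (4 * Real.pi)) * Real.log s := by
      ext s
      simp [radialProfile]
    rw [hP]
    refine Tendsto.const_mul_atBot_of_neg ?_ Real.tendsto_log_nhdsGT_zero
    have := Real.pi_pos
    simp only [neg_lt_zero]
    positivity
  · have hP : radialProfile N = fun s =>
        (1 / ((N:ℝ) * ((N:ℝ) - 2) * omegaN N)) * s ^ (((2:ℝ) - (N:ℝ)) / 2) := by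
      ext s
      simp [radialProfile, h]
    have hN3 : (3:ℝ) ≤ N := by exact_mod_cast (by omega : 3 ≤ N)
    have hN2 : 0 < (N:ℝ) - 2 := by linarith
    rw [hP]
    exact (tendsto_rpow_neg_nhdsGT_zero (by linarith)).const_mul_atTop (by positivity)

lemma hasFDerivAt_norm_sub_sq {N : ℕ} (w z : EN N) :
    HasFDerivAt (fun w' : EN N => ‖w' - z‖ ^ 2) ((2:ℝ) • innerSL ℝ (w - z)) w := by
  refine ((hasFDerivAt_id w).sub_const z).norm_sq.congr_fderiv ?_
  ext v
  simp

lemma hasFDerivAt_reflSq {N : ℕ} (w z : EN N) :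
    HasFDerivAt (fun w' : EN N => reflSq w' z) ((2:ℝ) • innerSL ℝ (‖z‖ ^ 2 • w - z)) w := by
  have h1 : HasFDerivAt (fun w' : EN N => ‖w'‖ ^ 2) ((2:ℝ) • innerSL ℝ w) w := by
    simpa using hasFDerivAt_norm_sub_sq w 0
  have h2 : HasFDerivAt (fun w' : EN N => inner ℝ w' z) (innerSL ℝ z) w := by
    simpa [real_inner_comm] using (innerSL ℝ z).hasFDerivAt (x := w)
  refine (((h1.mul_const (‖z‖ ^ 2)).sub (h2.const_mul 2)).add_const 1).congr_fderiv ?_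
  ext v
  simp
  ring

lemma hasFDerivAt_radialProfile_sub {N : ℕ} (hN : 2 ≤ N) {w z : EN N} (hwz : w ≠ z)
    (hQ : 0 < reflSq w z) :
    HasFDerivAt (fun w' => radialProfile N (‖w' - z‖ ^ 2) - radialProfile N (reflSq w' z))
      (-(1 / (N * omegaN N)) • innerSL ℝ ((‖w - z‖ ^ N)⁻¹ • (w - z)
        - (√(reflSq w z) ^ N)⁻¹ • (‖z‖ ^ 2 • w - z))) w := by
  have h1 := (hasDerivAt_radialProfile hN (norm_pos_iff.mpr (sub_ne_zero.mpr hwz)))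
    |>.comp_hasFDerivAt w (hasFDerivAt_norm_sub_sq w z)
  have h2 := hasDerivAt_radialProfile hN (Real.sqrt_pos.mpr hQ)
  rw [Real.sq_sqrt hQ.le] at h2
  refine (h1.sub (h2.comp_hasFDerivAt w (hasFDerivAt_reflSq w z))).congr_fderiv ?_
  ext v
  simp only [sub_apply, smul_apply, innerSL_apply_apply,
    inner_sub_left, inner_smul_left, smul_eq_mul, conj_trivial]
  ring

lemma G0_eventuallyEq {N : ℕ} {w : EN N} (hw : w ≠ 0) (z : EN N) :
    (fun w' => G0 N w' z) =ᶠ[𝓝 w]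
      fun w' => radialProfile N (‖w' - z‖ ^ 2) - radialProfile N (reflSq w' z) := by
  filter_upwards [isOpen_ne.mem_nhds hw] with w' hw'
  exact G0_eq_radialProfile_sub hw' z

lemma reflSq_pos {N : ℕ} {w z : EN N} (hw : 1 < ‖w‖) (hz : 1 < ‖z‖) : 0 < reflSq w z := by
  rw [reflSq_eq_add]
  have h1 : 0 < ‖w‖ ^ 2 - 1 := by nlinarith
  have h2 : 0 < ‖z‖ ^ 2 - 1 := by nlinarith
  positivity

lemma pd_G0 {N : ℕ} (hN : 2 ≤ N) {w z : EN N} (hw : 1 < ‖w‖) (hz : 1 < ‖z‖) (hwz : w ≠ z)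
    (i : Fin N) :
    pd (fun w' => G0 N w' z) i w = -(1 / (N * omegaN N)) *
      ((w i - z i) / ‖w - z‖ ^ N - (‖z‖ ^ 2 • w - z) i / √(reflSq w z) ^ N) := by
  have hw0 : w ≠ 0 := norm_pos_iff.mp (by linarith)
  rw [pd, ((hasFDerivAt_radialProfile_sub hN hwz (reflSq_pos hw hz)).congr_of_eventuallyEq
    (G0_eventuallyEq hw0 z)).fderiv]
  simp only [smul_apply, innerSL_apply_apply, smul_eq_mul,
    EuclideanSpace.inner_single_right, conj_trivial, one_mul, PiLp.sub_apply, PiLp.smul_apply]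
  ring

lemma pd_G0_diag {N : ℕ} (hN : 2 ≤ N) {z : EN N} (hz : 1 < ‖z‖) (i : Fin N) :
    pd (fun w' => G0 N w' z) i z = 0 := by
  have hz0 : z ≠ 0 := norm_pos_iff.mp (by linarith)
  have hQ := reflSq_pos hz hz
  have : Nontrivial (EN N) := ⟨z, 0, hz0⟩
  rw [pd, fderiv_zero_of_not_differentiableAt]
  · rfl
  intro hd
  have hcont := hd.continuousAt.tendsto.mono_left (nhdsWithin_le_nhds (s := {z}ᶜ))
  have hdist : Tendsto (fun w' : EN N => ‖w' - z‖ ^ 2) (𝓝[≠] z) (𝓝[>] 0) := by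
    refine tendsto_nhdsWithin_iff.mpr ⟨?_, ?_⟩
    · have h : ContinuousAt (fun w' : EN N => ‖w' - z‖ ^ 2) z := by fun_prop
      simpa [ContinuousAt] using h.tendsto.mono_left (nhdsWithin_le_nhds (s := {z}ᶜ))
    · filter_upwards [self_mem_nhdsWithin] with w' hw'
      have := norm_pos_iff.mpr (sub_ne_zero.mpr hw')
      exact pow_pos this 2
  have hrefl : ContinuousAt (fun w' : EN N => radialProfile N (reflSq w' z)) z := by
    have h2 := hasDerivAt_radialProfile hN (Real.sqrt_pos.mpr hQ)
    rw [Real.sq_sqrt hQ.le] at h2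
    exact h2.continuousAt.comp (f := fun w' => reflSq w' z) (hasFDerivAt_reflSq z z).continuousAt
  have hsum := hcont.add (hrefl.tendsto.mono_left (nhdsWithin_le_nhds (s := {z}ᶜ)))
  refine not_tendsto_nhds_of_tendsto_atTop
    (((tendsto_radialProfile_atTop hN).comp hdist).congr' ?_) _ hsum
  filter_upwards [(G0_eventuallyEq hz0 z).filter_mono nhdsWithin_le_nhds] with w' hw'
  simp [hw']

lemma fderiv_G0_neg_normal {N : ℕ} (hN : 2 ≤ N) {w z : EN N} (hw : 1 < ‖w‖) (hz : ‖z‖ = 1) :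
    fderiv ℝ (fun z' => G0 N w z') z (-z)
      = (1 / ((N:ℝ) * omegaN N)) * (1 - ‖w‖ ^ 2) / ‖w - z‖ ^ N := by
  have hw0 : w ≠ 0 := norm_pos_iff.mp (by linarith)
  have hzw : z ≠ w := by
    rintro rfl
    linarith
  have hQ : reflSq z w = ‖z - w‖ ^ 2 := by
    rw [reflSq_eq_add, hz]
    ring
  have hpos : 0 < ‖z - w‖ := norm_pos_iff.mpr (sub_ne_zero.mpr hzw)
  have hG : (fun z' => G0 N w z') =
      fun z' => radialProfile N (‖z' - w‖ ^ 2) - radialProfile N (reflSq z' w) := by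
    ext z'
    rw [G0_eq_radialProfile_sub hw0, norm_sub_rev, reflSq_comm]
  rw [hG, (hasFDerivAt_radialProfile_sub hN hzw (by rw [hQ]; positivity)).fderiv, hQ,
    Real.sqrt_sq hpos.le, norm_sub_rev w z]
  simp only [smul_apply, innerSL_apply_apply, inner_sub_left,
    inner_smul_left, inner_neg_right, real_inner_self_eq_norm_sq, hz, smul_eq_mul, conj_trivial]
  ring

lemma abs_pd_G0_le {N : ℕ} (hN : 2 ≤ N) {w z : EN N} (hw : 1 < ‖w‖) (hz : 1 < ‖z‖)
    (i : Fin N) :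
    |pd (fun w' => G0 N w' z) i w|
      ≤ 2 * (1 / ((N:ℝ) * omegaN N)) * ‖z‖ / ‖w - z‖ ^ (N - 1) := by
  have hω := omegaN_pos N
  rcases eq_or_ne w z with rfl | hwz
  · rw [pd_G0_diag hN hw, abs_zero]
    positivity
  obtain ⟨n, rfl⟩ : ∃ n, N = n + 1 := ⟨N - 1, by omega⟩
  have hQ := reflSq_pos hw hz
  have hpos : 0 < ‖w - z‖ := norm_pos_iff.mpr (sub_ne_zero.mpr hwz)
  have hle : ‖w - z‖ ≤ √(reflSq w z) := by
    apply Real.le_sqrt_of_sq_le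
    rw [reflSq_eq_add]
    nlinarith [mul_pos (by nlinarith : 0 < ‖w‖ ^ 2 - 1) (by nlinarith : 0 < ‖z‖ ^ 2 - 1)]
  have hspos : 0 < √(reflSq w z) := Real.sqrt_pos.mpr hQ
  have hnorm : ‖‖z‖ ^ 2 • w - z‖ = ‖z‖ * √(reflSq w z) := by
    rw [← Real.sqrt_sq (norm_nonneg (‖z‖ ^ 2 • w - z)), norm_sq_smul_sub_sq,
      Real.sqrt_mul (by positivity), Real.sqrt_sq (norm_nonneg z)]
  have h1 : |(w i - z i) / ‖w - z‖ ^ (n + 1)| ≤ ‖z‖ / ‖w - z‖ ^ n := by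
    rw [abs_div, abs_of_pos (by positivity : 0 < ‖w - z‖ ^ (n + 1))]
    calc |w i - z i| / ‖w - z‖ ^ (n + 1) ≤ ‖w - z‖ / ‖w - z‖ ^ (n + 1) := by
          gcongr
          exact PiLp.norm_apply_le (w - z) i
      _ = 1 / ‖w - z‖ ^ n := by
          rw [pow_succ]
          field_simp
      _ ≤ ‖z‖ / ‖w - z‖ ^ n := by gcongr
  have h2 : |(‖z‖ ^ 2 • w - z) i / √(reflSq w z) ^ (n + 1)| ≤ ‖z‖ / ‖w - z‖ ^ n := by
    rw [abs_div, abs_of_pos (by positivity : 0 < √(reflSq w z) ^ (n + 1))]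
    calc |(‖z‖ ^ 2 • w - z) i| / √(reflSq w z) ^ (n + 1)
        ≤ ‖z‖ * √(reflSq w z) / √(reflSq w z) ^ (n + 1) := by
          gcongr
          exact (PiLp.norm_apply_le (‖z‖ ^ 2 • w - z) i).trans hnorm.le
      _ = ‖z‖ / √(reflSq w z) ^ n := by
          rw [pow_succ]
          field_simp
      _ ≤ ‖z‖ / ‖w - z‖ ^ n := by gcongr
  rw [pd_G0 hN hw hz hwz, abs_mul, abs_neg, abs_of_nonneg (by positivity), Nat.add_sub_cancel]
  calc _ ≤ 1 / (((n + 1 : ℕ) : ℝ) * omegaN (n + 1))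
        * (‖z‖ / ‖w - z‖ ^ n + ‖z‖ / ‖w - z‖ ^ n) := by
        gcongr
        exact (abs_sub _ _).trans (add_le_add h1 h2)
    _ = _ := by ring

lemma abs_pd_G0_add_le {N : ℕ} (hN : 2 ≤ N) {w z : EN N} (hw : 2 ≤ ‖w‖) (hz : 1 < ‖z‖)
    (i : Fin N) :
    |pd (fun w' => G0 N w' z) i w
        + (1 / ((N:ℝ) * omegaN N)) * (w i - z i) / ‖w - z‖ ^ N|
      ≤ 1 / ((N:ℝ) * omegaN N) * 2 ^ (N + 1) / (‖w‖ ^ (N - 1) * ‖z‖ ^ (N - 2)) := by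
  have hω := omegaN_pos N
  rcases eq_or_ne w z with rfl | hwz
  · rw [pd_G0_diag hN hz, sub_self, mul_zero, zero_div, add_zero, abs_zero]
    positivity
  obtain ⟨n, rfl⟩ : ∃ n, N = n + 2 := ⟨N - 2, by omega⟩
  have hwpos : 0 < ‖w‖ := by linarith
  have hzpos : 0 < ‖z‖ := by linarith
  have hwz1 : 2 ≤ ‖w‖ * ‖z‖ := by nlinarith
  have hle : ‖w‖ * ‖z‖ / 2 ≤ √(reflSq w z) :=
    (by linarith : ‖w‖ * ‖z‖ / 2 ≤ ‖w‖ * ‖z‖ - 1).trans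
      (Real.le_sqrt_of_sq_le (sq_le_reflSq w z))
  have hnum : |(‖z‖ ^ 2 • w - z) i| ≤ 2 * (‖z‖ ^ 2 * ‖w‖) := by
    refine (PiLp.norm_apply_le (‖z‖ ^ 2 • w - z) i).trans ((norm_sub_le _ _).trans ?_)
    rw [norm_smul, norm_pow, norm_norm]
    nlinarith
  rw [pd_G0 hN (by linarith) hz hwz]
  have hrw : -(1 / (((n + 2 : ℕ) : ℝ) * omegaN (n + 2))) *
      ((w i - z i) / ‖w - z‖ ^ (n + 2) - (‖z‖ ^ 2 • w - z) i / √(reflSq w z) ^ (n + 2))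
        + (1 / (((n + 2 : ℕ) : ℝ) * omegaN (n + 2))) * (w i - z i) / ‖w - z‖ ^ (n + 2)
      = 1 / (((n + 2 : ℕ) : ℝ) * omegaN (n + 2)) *
        ((‖z‖ ^ 2 • w - z) i / √(reflSq w z) ^ (n + 2)) := by ring
  rw [hrw, abs_mul, abs_of_nonneg (by positivity), abs_div,
    abs_of_nonneg (by positivity : 0 ≤ √(reflSq w z) ^ (n + 2)), mul_div_assoc]
  refine mul_le_mul_of_nonneg_left ?_ (by positivity)
  calc |(‖z‖ ^ 2 • w - z) i| / √(reflSq w z) ^ (n + 2)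
      ≤ 2 * (‖z‖ ^ 2 * ‖w‖) / (‖w‖ * ‖z‖ / 2) ^ (n + 2) := by gcongr
    _ = 2 ^ (n + 2 + 1) / (‖w‖ ^ (n + 2 - 1) * ‖z‖ ^ (n + 2 - 2)) := by
      rw [show n + 2 - 1 = n + 1 by omega, Nat.add_sub_cancel, div_pow, mul_pow]
      field_simp
      ring

/-- Lemma 2.2 of the paper: (i) the normal derivative of `G₀(w,·)` on the unit
sphere in the direction `ν_z = -z`; (ii) the uniform bound
`|∂G₀/∂w_i| ≤ C|z|/|w-z|^{N-1}`; (iii) the expansion of `∂G₀/∂w_i` as `|w| → ∞`,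
uniformly in `|z| > 1`. -/
theorem stmt8 {N : ℕ} (hN : 2 ≤ N) :
    (∀ w z : EN N, 1 < ‖w‖ → ‖z‖ = 1 →
      fderiv ℝ (fun z' => G0 N w z') z (-z)
        = (1 / ((N:ℝ) * omegaN N)) * (1 - ‖w‖ ^ 2) / ‖w - z‖ ^ N) ∧
    (∃ C : ℝ, ∀ w z : EN N, 1 < ‖w‖ → 1 < ‖z‖ → ∀ i : Fin N,
      |pd (fun w' => G0 N w' z) i w| ≤ C * ‖z‖ / ‖w - z‖ ^ (N - 1)) ∧
    (∃ C R : ℝ, ∀ w z : EN N, R ≤ ‖w‖ → 1 < ‖z‖ → ∀ i : Fin N,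
      |pd (fun w' => G0 N w' z) i w
          + (1 / ((N:ℝ) * omegaN N)) * (w i - z i) / ‖w - z‖ ^ N|
        ≤ C / (‖w‖ ^ (N - 1) * ‖z‖ ^ (N - 2))) := by
  exact ⟨fun _ _ hw hz => fderiv_G0_neg_normal hN hw hz,
    ⟨_, fun _ _ hw hz i => abs_pd_G0_le hN hw hz i⟩,
    ⟨_, 2, fun _ _ hw hz i => abs_pd_G0_add_le hN hw hz i⟩⟩
end
end

section
/- Let N = 2, let Ω ⊂ ℝ² be a smooth bounded domain, P ∈ Ω, and for small ε > 0 let ψ_ε be the harmonic function on Ω \ B(P,ε) with boundary values ψ_ε = 1 on ∂Ω and ψ_ε = 0 on ∂B(P,ε). Then, uniformly for x ∈ Ω \ B(P,ε) as ε → 0, ψ_ε(x) = 1 + (2π/log ε)(1 + o(1)) G(x,P) + O(1/|log ε|²). -/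
open Filter Set Topology Metric MeasureTheory

noncomputable section

/-- For a `C²` function, `pd2` is the second Fréchet derivative on basis vectors. -/
lemma pd2_eq_fderiv_fderiv {N : ℕ} {u : EN N → ℝ} {x : EN N} (hu : ContDiffAt ℝ 2 u x)
    (i j : Fin N) :
    pd2 u i j x
      = fderiv ℝ (fderiv ℝ u) x (EuclideanSpace.single j 1) (EuclideanSpace.single i 1) := by
  have h : DifferentiableAt ℝ (fderiv ℝ u) x :=
    (hu.fderiv_right (m := 1) (by norm_num)).differentiableAt (by norm_num)
  have h2 := h.hasFDerivAt.clm_apply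
    (hasFDerivAt_const (EuclideanSpace.single i (1 : ℝ) : EN N) x)
  have h3 : HasFDerivAt (fun y => pd u i y) _ x := h2
  rw [pd2, h3.fderiv]
  simp

open InnerProductSpace in
/-- The coordinate Laplacian agrees with Mathlib's Laplacian on `C²` functions. -/
lemma lap_eq_laplacian {N : ℕ} {u : EN N → ℝ} {x : EN N} (hu : ContDiffAt ℝ 2 u x) :
    lap u x = Laplacian.laplacian u x := by
  rw [laplacian_eq_iteratedFDeriv_orthonormalBasis u (EuclideanSpace.basisFun (Fin N) ℝ), lap]
  refine Finset.sum_congr rfl fun i _ => ?_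
  rw [pd2_eq_fderiv_fderiv hu, iteratedFDeriv_two_apply]
  simp

open InnerProductSpace in
lemma harmonicOnNhd_of_lap_eq_zero {N : ℕ} {u : EN N → ℝ} {D : Set (EN N)} (hD : IsOpen D)
    (hu : ContDiffOn ℝ 2 u D) (h : ∀ x ∈ D, lap u x = 0) : HarmonicOnNhd u D := by
  intro x hx
  refine ⟨hu.contDiffAt (hD.mem_nhds hx), ?_⟩
  filter_upwards [hD.mem_nhds hx] with y hy
  rw [← lap_eq_laplacian (hu.contDiffAt (hD.mem_nhds hy)), h y hy, Pi.zero_apply]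

/-- Second derivative test (necessary condition) along a coordinate direction. -/
lemma IsLocalMax.pd2_nonpos {N : ℕ} {u : EN N → ℝ} {z : EN N} (hz : IsLocalMax u z)
    (hu : ContDiffAt ℝ 2 u z) (i : Fin N) : pd2 u i i z ≤ 0 := by
  by_contra! hpos
  set e : EN N := EuclideanSpace.single i 1
  set g : ℝ → ℝ := fun t => u (z + t • e) with hg
  have hline : ∀ t : ℝ, HasDerivAt (fun t : ℝ => z + t • e) e t := fun t => by
    simpa using ((hasDerivAt_id t).smul_const e).const_add z
  have hcont : Tendsto (fun t : ℝ => z + t • e) (𝓝 0) (𝓝 z) := by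
    simpa using (hline 0).continuousAt.tendsto
  have hz0 : z + (0 : ℝ) • e = z := by simp
  have hdiff : ∀ᶠ y in 𝓝 z, DifferentiableAt ℝ u y := by
    filter_upwards [hu.eventually (by simp)] with y hy
    exact hy.differentiableAt (by norm_num)
  have hg1 : deriv g =ᶠ[𝓝 0] fun t => pd u i (z + t • e) := by
    filter_upwards [hcont.eventually hdiff] with t ht
    exact (ht.hasFDerivAt.comp_hasDerivAt t (hline t)).deriv
  have hd : DifferentiableAt ℝ (fun y => pd u i y) z := by
    have h : DifferentiableAt ℝ (fderiv ℝ u) z :=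
      (hu.fderiv_right (m := 1) (by norm_num)).differentiableAt (by norm_num)
    exact h.clm_apply (differentiableAt_const e)
  have hg2 : deriv (deriv g) 0 = pd2 u i i z := by
    rw [hg1.deriv_eq]
    have hd' : HasFDerivAt (fun y => pd u i y) (fderiv ℝ (fun y => pd u i y) z)
        (z + (0 : ℝ) • e) := by
      rw [hz0]; exact hd.hasFDerivAt
    exact (hd'.comp_hasDerivAt 0 (hline 0)).deriv
  have hmax : IsLocalMax g 0 := by
    have h : ∀ᶠ t in 𝓝 (0 : ℝ), u (z + t • e) ≤ u z := hcont.eventually hz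
    filter_upwards [h] with t ht
    simpa [hg] using ht
  have hgc : ContinuousAt g 0 := by
    have h : ContinuousAt u (z + (0 : ℝ) • e) := by rw [hz0]; exact hu.continuousAt
    exact ContinuousAt.comp (f := fun t : ℝ => z + t • e) h (hline 0).continuousAt
  have hmin : IsLocalMin g 0 :=
    isLocalMin_of_deriv_deriv_pos (by rw [hg2]; exact hpos) hmax.deriv_eq_zero hgc
  have hconst : g =ᶠ[𝓝 0] fun _ => g 0 := by
    filter_upwards [hmax, hmin] with t h1 h2 using le_antisymm h1 h2
  have h0 : deriv (deriv g) 0 = 0 := by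
    rw [hconst.deriv.deriv_eq]
    simp
  linarith

lemma pd_norm_sub_sq {N : ℕ} (P y : EN N) (i : Fin N) :
    pd (fun x : EN N => ‖x - P‖ ^ 2) i y = 2 * (y i - P i) := by
  have h := ((hasFDerivAt_id y).sub_const P).norm_sq
  simp only [id] at h
  rw [pd, h.fderiv]
  simp [EuclideanSpace.inner_single_right]

lemma hasFDerivAt_coord_sub {N : ℕ} (P y : EN N) (i : Fin N) :
    HasFDerivAt (fun x : EN N => x i - P i) (EuclideanSpace.proj (𝕜 := ℝ) i) y := by
  have h : HasFDerivAt (fun x : EN N => x i) (EuclideanSpace.proj (𝕜 := ℝ) i) y :=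
    (EuclideanSpace.proj (𝕜 := ℝ) i).hasFDerivAt
  exact h.sub_const (P i)

lemma lap_norm_sq {N : ℕ} (y : EN N) : lap (fun x : EN N => ‖x‖ ^ 2) y = 2 * N := by
  have h : ∀ i : Fin N, pd2 (fun x : EN N => ‖x‖ ^ 2) i i y = 2 := fun i => by
    have h1 : (fun y => pd (fun x : EN N => ‖x‖ ^ 2) i y) = fun y => 2 * (y i - (0 : EN N) i) := by
      funext y
      simpa using pd_norm_sub_sq 0 y i
    rw [pd2, h1, ((hasFDerivAt_coord_sub 0 y i).const_mul 2).fderiv]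
    simp
  simp [lap, h, mul_comm]

open InnerProductSpace in
/-- Weak maximum principle for harmonic functions on bounded open sets. -/
lemma nonpos_of_harmonicOnNhd {N : ℕ} [NeZero N] {D : Set (EN N)} (hDo : IsOpen D)
    (hDb : Bornology.IsBounded D) {u : EN N → ℝ} (hu : HarmonicOnNhd u D)
    (huc : ContinuousOn u (closure D)) (hb : ∀ x ∈ frontier D, u x ≤ 0) :
    ∀ x ∈ D, u x ≤ 0 := by
  intro x₀ hx₀
  by_contra! hpos
  obtain ⟨R, hR0, hR⟩ := hDb.closure.exists_pos_norm_le
  set δ : ℝ := u x₀ / (2 * R ^ 2) with hδ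
  have hδpos : 0 < δ := by positivity
  have hδR : δ * R ^ 2 = u x₀ / 2 := by rw [hδ]; field_simp
  obtain ⟨z, hzD, hzmax⟩ := hDb.isCompact_closure.exists_isMaxOn ⟨x₀, subset_closure hx₀⟩
    (huc.add (f := u) (g := δ • fun x : EN N => ‖x‖ ^ 2)
      (Continuous.continuousOn (by fun_prop)))
  have hzv : u x₀ ≤ u z + δ * ‖z‖ ^ 2 := by
    have h : u x₀ + δ * ‖x₀‖ ^ 2 ≤ u z + δ * ‖z‖ ^ 2 := hzmax (subset_closure hx₀)
    have : 0 ≤ δ * ‖x₀‖ ^ 2 := by positivity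
    linarith
  have hzR : δ * ‖z‖ ^ 2 ≤ δ * R ^ 2 := by
    have := hR z hzD
    gcongr
  have hz : z ∈ D := by
    by_contra hz
    have : z ∈ frontier D := by rw [hDo.frontier_eq]; exact ⟨hzD, hz⟩
    linarith [hb z this]
  have hsq : ContDiffAt ℝ 2 (fun x : EN N => ‖x‖ ^ 2) z := (contDiff_norm_sq ℝ).contDiffAt
  have hsq' : ContDiffAt ℝ 2 (δ • fun x : EN N => ‖x‖ ^ 2) z := hsq.const_smul δ
  have hvC : ContDiffAt ℝ 2 (u + δ • fun x : EN N => ‖x‖ ^ 2) z :=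
    (hu z hz).1.add hsq'
  have hloc : IsLocalMax (u + δ • fun x : EN N => ‖x‖ ^ 2) z :=
    hzmax.isLocalMax (mem_of_superset (hDo.mem_nhds hz) subset_closure)
  have hle : lap (u + δ • fun x : EN N => ‖x‖ ^ 2) z ≤ 0 :=
    Finset.sum_nonpos fun i _ => hloc.pd2_nonpos hvC i
  rw [lap_eq_laplacian hvC, (hu z hz).1.laplacian_add hsq',
    laplacian_smul δ hsq, ← lap_eq_laplacian hsq, lap_norm_sq, (hu z hz).2.self_of_nhds] at hle
  have hN : (0 : ℝ) < N := by exact_mod_cast Nat.pos_of_ne_zero (NeZero.ne N)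
  have : 0 < δ * (2 * N) := by positivity
  simp only [Pi.zero_apply, smul_eq_mul, zero_add] at hle
  linarith

lemma pd_log_norm_sub {N : ℕ} {P y : EN N} (hy : y ≠ P) (i : Fin N) :
    pd (fun x : EN N => Real.log ‖x - P‖) i y = (y i - P i) * (‖y - P‖ ^ 2)⁻¹ := by
  have hne : ‖y - P‖ ^ 2 ≠ 0 := by simpa [sub_eq_zero] using hy
  have h := ((((hasFDerivAt_id y).sub_const P).norm_sq).log hne).const_mul (1 / 2)
  have he : (fun x : EN N => Real.log ‖x - P‖)
      = fun x : EN N => 1 / 2 * Real.log (‖id x - P‖ ^ 2) := by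
    funext x
    rw [Real.log_pow, id]
    push_cast
    ring
  rw [pd, he, h.fderiv]
  simp [EuclideanSpace.inner_single_right]
  ring

lemma lap_log_norm_sub {P y : EN 2} (hy : y ≠ P) :
    lap (fun x : EN 2 => Real.log ‖x - P‖) y = 0 := by
  have hne : ‖y - P‖ ^ 2 ≠ 0 := by simpa [sub_eq_zero] using hy
  have h : ∀ i : Fin 2, pd2 (fun x : EN 2 => Real.log ‖x - P‖) i i y
      = (‖y - P‖ ^ 2)⁻¹ - 2 * (y i - P i) ^ 2 / (‖y - P‖ ^ 2) ^ 2 := fun i => by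
    have h1 : (fun y => pd (fun x : EN 2 => Real.log ‖x - P‖) i y)
        =ᶠ[𝓝 y] fun y => (y i - P i) * (‖id y - P‖ ^ 2)⁻¹ := by
      filter_upwards [isOpen_ne.mem_nhds hy] with x hx using pd_log_norm_sub hx i
    have h2 := (hasFDerivAt_coord_sub P y i).mul
      ((hasDerivAt_inv hne).comp_hasFDerivAt y ((hasFDerivAt_id y).sub_const P).norm_sq)
    have h3 : HasFDerivAt (fun y => (y i - P i) * (‖id y - P‖ ^ 2)⁻¹) _ y := h2
    rw [pd2, h1.fderiv_eq, h3.fderiv]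
    simp [EuclideanSpace.inner_single_right]
    ring
  have hs : ‖y - P‖ ^ 2 = (y 0 - P 0) ^ 2 + (y 1 - P 1) ^ 2 := by
    simp [EuclideanSpace.norm_sq_eq, Fin.sum_univ_two]
  rw [lap, Fin.sum_univ_two, h, h]
  have hsum : (‖y - P‖ ^ 2)⁻¹ + (‖y - P‖ ^ 2)⁻¹
      = 2 * ((y 0 - P 0) ^ 2 + (y 1 - P 1) ^ 2) / (‖y - P‖ ^ 2) ^ 2 := by
    rw [← hs]
    field_simp
    norm_num
  linear_combination hsum

open InnerProductSpace in
lemma harmonicOnNhd_log_norm_sub (P : EN 2) :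
    HarmonicOnNhd (fun x : EN 2 => Real.log ‖x - P‖) {P}ᶜ := by
  refine harmonicOnNhd_of_lap_eq_zero isOpen_compl_singleton ?_ fun x hx => lap_log_norm_sub hx
  intro x hx
  have hx' : x - P ≠ 0 := sub_ne_zero.mpr hx
  exact (((contDiffAt_id.sub contDiffAt_const).norm ℝ hx').log
    (norm_ne_zero_iff.mpr hx')).contDiffWithinAt

lemma frontier_diff_closedBall_subset {N : ℕ} (Ω : Set (EN N)) (P : EN N) (ε : ℝ) :
    frontier (Ω \ closedBall P ε) ⊆ frontier Ω ∪ sphere P ε := by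
  intro x hx
  rw [sdiff_eq] at hx
  rcases frontier_inter_subset _ _ hx with h | h
  · exact Or.inl h.1
  · rw [frontier_compl] at h
    exact Or.inr (frontier_closedBall_subset_sphere h.2)

lemma le_norm_sub_of_mem_closure {N : ℕ} {Ω : Set (EN N)} {P x : EN N} {ε : ℝ}
    (hx : x ∈ closure (Ω \ closedBall P ε)) : ε ≤ ‖x - P‖ := by
  have hc : IsClosed {y : EN N | ε ≤ ‖y - P‖} := isClosed_le (by fun_prop) (by fun_prop)
  refine closure_minimal (fun y hy => ?_) hc hx
  have h := hy.2
  rw [mem_closedBall, dist_eq_norm, not_le] at h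
  exact h.le

/-- Lemma 2.4 of the paper.  For `N = 2`, let `ψ ε` be harmonic in
`Ω \ B(P,ε)` with `ψ ε = 1` on `∂Ω` and `ψ ε = 0` on `∂B(P,ε)`.  Then, uniformly in
`x ∈ Ω \ B(P,ε)`, `ψ ε (x) = 1 + (2π/log ε)(1 + o(1)) G(x,P) + O(1/|log ε|²)`, where
`G = fundS 2 + H` is the Dirichlet Green function of `Ω`. -/
theorem stmt9
    (Ω : Set (EN 2)) (hΩo : IsOpen Ω) (hΩb : Bornology.IsBounded Ω)
    (P : EN 2) (hP : P ∈ Ω)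
    (H : EN 2 → EN 2 → ℝ) (hH : IsRegularPart Ω (fundS 2) H)
    (ε₀ : ℝ) (hε₀ : 0 < ε₀)
    (ψ : ℝ → EN 2 → ℝ)
    (hball : ∀ ε ∈ Ioo (0:ℝ) ε₀, closedBall P ε ⊆ Ω)
    (hψ : ∀ ε ∈ Ioo (0:ℝ) ε₀,
      ContDiffOn ℝ 2 (ψ ε) (Ω \ closedBall P ε) ∧
      (∀ x ∈ Ω \ closedBall P ε, lap (ψ ε) x = 0) ∧
      ContinuousOn (ψ ε) (closure (Ω \ closedBall P ε)) ∧
      (∀ x ∈ frontier Ω, ψ ε x = 1) ∧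
      (∀ x ∈ sphere P ε, ψ ε x = 0)) :
    ∃ (C : ℝ) (c : ℝ → ℝ),
      Tendsto c (𝓝[>] (0:ℝ)) (𝓝 0) ∧
      ∀ᶠ ε in 𝓝[>] (0:ℝ), ∀ x ∈ Ω \ closedBall P ε,
        |ψ ε x - 1 - (2 * Real.pi / Real.log ε) * (fundS 2 x P + H x P)|
          ≤ |c ε| * (2 * Real.pi) * |fundS 2 x P + H x P| / |Real.log ε|
            + C / (Real.log ε) ^ 2 := by
  obtain ⟨hHC, hHlap, hHcont, hHbd⟩ := hH P hP
  set G : EN 2 → ℝ := fun x => fundS 2 x P + H x P with hG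
  have hfund : ∀ x, fundS 2 x P = -(1 / (2 * Real.pi)) * Real.log ‖x - P‖ := fun x => by
    simp [fundS]
  have hπ := Real.pi_pos
  obtain ⟨K, hK⟩ : ∃ K, ∀ x ∈ closedBall P (ε₀ / 2), ‖H x P‖ ≤ K :=
    (isCompact_closedBall P (ε₀ / 2)).exists_bound_of_continuousOn
      (hHcont.mono ((hball _ ⟨by linarith, by linarith⟩).trans subset_closure))
  have hK0 : 0 ≤ K := (norm_nonneg _).trans (hK P (mem_closedBall_self (by linarith)))
  have hlog : Tendsto Real.log (𝓝[>] (0 : ℝ)) atBot := Real.tendsto_log_nhdsGT_zero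
  refine ⟨0, fun ε => 4 * Real.pi * K / Real.log ε, hlog.const_div_atBot _, ?_⟩
  filter_upwards [Ioo_mem_nhdsGT (show (0 : ℝ) < ε₀ / 2 by linarith),
    hlog.eventually_le_atBot (-(4 * Real.pi * K + 1))] with ε hε hL x hx
  obtain ⟨hψC, hψlap, hψcont, hψΩ, hψP⟩ := hψ ε ⟨hε.1, by linarith [hε.2]⟩
  set D : Set (EN 2) := Ω \ closedBall P ε with hD
  have hDo : IsOpen D := hΩo.sdiff isClosed_closedBall
  have hDb : Bornology.IsBounded D := hΩb.subset sdiff_subset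
  have hcl : ∀ y ∈ closure D, y ≠ P := fun y hy h => by
    have := le_norm_sub_of_mem_closure hy
    rw [h, sub_self, norm_zero] at this
    linarith [hε.1]
  have hψh : InnerProductSpace.HarmonicOnNhd (ψ ε) D := harmonicOnNhd_of_lap_eq_zero hDo hψC hψlap
  have hGh : InnerProductSpace.HarmonicOnNhd G D := by
    have h1 : InnerProductSpace.HarmonicOnNhd (fun x : EN 2 => Real.log ‖x - P‖) D :=
      (harmonicOnNhd_log_norm_sub P).mono fun y hy => hcl y (subset_closure hy)
    have h2 : InnerProductSpace.HarmonicOnNhd (fun x => H x P) D :=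
      (harmonicOnNhd_of_lap_eq_zero hΩo hHC hHlap).mono sdiff_subset
    have h3 := (h1.const_smul (c := -(1 / (2 * Real.pi)))).add h2
    have he : G = (-(1 / (2 * Real.pi))) • (fun x : EN 2 => Real.log ‖x - P‖)
        + fun x => H x P := by
      funext x
      simp [hG, hfund]
    rwa [he]
  have hGc : ContinuousOn G (closure D) := by
    refine ContinuousOn.add ?_ (hHcont.mono (closure_mono sdiff_subset))
    simp only [hfund]
    refine continuousOn_const.mul (ContinuousOn.log (by fun_prop) fun y hy => ?_)
    exact norm_ne_zero_iff.mpr (sub_ne_zero.mpr (hcl y hy))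
  have hGΩ : ∀ y ∈ frontier Ω, G y = 0 := hHbd
  set L : ℝ := -Real.log ε with hLdef
  have hlogL : Real.log ε = -L := by rw [hLdef, neg_neg]
  have hL1 : 4 * Real.pi * K + 1 ≤ L := by linarith
  have hLpos : 0 < L := by
    have : 0 ≤ 4 * Real.pi * K := by positivity
    linarith
  set lam : ℝ := 8 * Real.pi ^ 2 * K / L ^ 2 with hlam
  have hlam0 : 0 ≤ lam := by positivity
  have key : ∀ s : ℝ, |s| = 1 →
      s * (ψ ε x - 1 - 2 * Real.pi / Real.log ε * G x) ≤ lam * G x := by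
    intro s hs
    have hu : InnerProductSpace.HarmonicOnNhd
        (s • ψ ε + ((s * (2 * Real.pi / L) - lam) • G + fun _ => -s)) D :=
      (hψh.const_smul).add ((hGh.const_smul).add (InnerProductSpace.harmonicOnNhd_const _))
    have huc : ContinuousOn (s • ψ ε + ((s * (2 * Real.pi / L) - lam) • G + fun _ => -s))
        (closure D) :=
      (hψcont.const_smul s).add ((hGc.const_smul _).add continuousOn_const)
    have hmain := nonpos_of_harmonicOnNhd hDo hDb hu huc (fun y hy => ?_) x hx
    · simp only [Pi.add_apply, Pi.smul_apply, smul_eq_mul] at hmain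
      rw [hlogL, div_neg]
      linarith
    · simp only [Pi.add_apply, Pi.smul_apply, smul_eq_mul]
      rcases frontier_diff_closedBall_subset Ω P ε hy with h | h
      · rw [hψΩ y h, hGΩ y h]
        simp
      · have hHy : |H y P| ≤ K := hK y (by
          rw [mem_closedBall, mem_sphere.mp h]; exact hε.2.le)
        have hGy : G y = L / (2 * Real.pi) + H y P := by
          simp only [hG, hfund]
          rw [← dist_eq_norm, mem_sphere.mp h, hlogL]
          ring
        have hGlow : L / (4 * Real.pi) ≤ G y := by
          have h1 : K ≤ L / (4 * Real.pi) := by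
            rw [le_div_iff₀ (by positivity)]
            linarith
          have h2 : L / (2 * Real.pi) = L / (4 * Real.pi) + L / (4 * Real.pi) := by
            field_simp; norm_num
          rw [hGy, h2]
          linarith [(abs_le.mp hHy).1]
        have h3 : lam * (L / (4 * Real.pi)) ≤ lam * G y :=
          mul_le_mul_of_nonneg_left hGlow hlam0
        have h4 : lam * (L / (4 * Real.pi)) = 2 * Real.pi / L * K := by
          rw [hlam]; field_simp; ring
        have h5 : s * H y P ≤ K := by
          calc s * H y P ≤ |s * H y P| := le_abs_self _
            _ = |H y P| := by rw [abs_mul, hs, one_mul]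
            _ ≤ K := hHy
        have h6 : 2 * Real.pi / L * (s * H y P) ≤ 2 * Real.pi / L * K :=
          mul_le_mul_of_nonneg_left h5 (by positivity)
        have h7 : s * (2 * Real.pi / L) * G y = s + 2 * Real.pi / L * (s * H y P) := by
          rw [hGy]; field_simp
        rw [hψP y h, sub_mul, h7]
        linarith
  have hp := key 1 (by simp)
  have hm := key (-1) (by simp)
  have habs : |ψ ε x - 1 - 2 * Real.pi / Real.log ε * G x| ≤ lam * |G x| :=
    (abs_le.mpr ⟨by linarith, by linarith⟩ : _ ≤ lam * G x).trans
      (mul_le_mul_of_nonneg_left (le_abs_self _) hlam0)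
  refine habs.trans (le_of_eq ?_)
  have hc : |4 * Real.pi * K / Real.log ε| = 4 * Real.pi * K / L := by
    rw [hlogL, div_neg, abs_neg, abs_of_nonneg (by positivity)]
  have hl : |Real.log ε| = L := by rw [hlogL, abs_neg, abs_of_pos hLpos]
  rw [hc, hl, hlam, zero_div, add_zero]
  change 8 * Real.pi ^ 2 * K / L ^ 2 * |G x| = 4 * Real.pi * K / L * (2 * Real.pi) * |G x| / L
  field_simp
  ring
end
end
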